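/- Let F be a Finsler metric on a nonempty open set U ⊆ ℝ^n (n ≥ 2), G its induced spray, and dV = dV_BH its Busemann–Hausdorff volume form. Suppose the S-curvature of (G, dV_BH) satisfies S = (n+1)cF for a constant c, and F is Einstein: R^m_m = (n−1)σ(x)F² for a smooth function σ on U. Then the Berwald–Weyl curvature of (G, dV_BH) satisfies W^o_k = F³ (θ/F)_{·k}, where θ := σ_{x^m} y^m. -/

import Mathlib

open scoped BigOperators
open MeasureTheory

noncomputable section BerwaldWeyl

/-- Points/vectors in local coordinates on `ℝⁿ`. -/
abbrev Vec (n : ℕ) := Fin n → ℝ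

/-- Partial derivative in the base (`x`) variable along the `i`-th coordinate. -/
def pdx {n : ℕ} (f : Vec n → Vec n → ℝ) (i : Fin n) : Vec n → Vec n → ℝ :=
  fun x y => fderiv ℝ (fun x' => f x' y) x (Pi.single i 1)

/-- Vertical derivative `f_{·i} = ∂f/∂y^i`. -/
def pdy {n : ℕ} (f : Vec n → Vec n → ℝ) (i : Fin n) : Vec n → Vec n → ℝ :=
  fun x y => fderiv ℝ (fun y' => f x y') y (Pi.single i 1)

/-- The slit fiber `ℝⁿ \ {0}`. -/
def slit (n : ℕ) : Set (Vec n) := {y | y ≠ 0}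

/-- A spray on `U ⊆ ℝⁿ`: a family `G^i(x,y)`, smooth on `U × (ℝⁿ \ {0})` and
positively 2-homogeneous in `y`. -/
def IsSpray {n : ℕ} (U : Set (Vec n)) (G : Fin n → Vec n → Vec n → ℝ) : Prop :=
  (∀ i, ContDiffOn ℝ (⊤ : ℕ∞) (fun p : Vec n × Vec n => G i p.1 p.2) (U ×ˢ slit n)) ∧
  (∀ i, ∀ x ∈ U, ∀ y ∈ slit n, ∀ c : ℝ, 0 < c → G i x (c • y) = c ^ 2 * G i x y)

/-- Nonlinear connection coefficients `N^i_j := ∂G^i/∂y^j`. -/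
def Nc {n : ℕ} (G : Fin n → Vec n → Vec n → ℝ) (i j : Fin n) : Vec n → Vec n → ℝ :=
  pdy (G i) j

/-- Berwald connection coefficients `Γ^i_{jk} := ∂²G^i/∂y^j∂y^k`. -/
def Γc {n : ℕ} (G : Fin n → Vec n → Vec n → ℝ) (i j k : Fin n) : Vec n → Vec n → ℝ :=
  pdy (pdy (G i) j) k

/-- Horizontal derivative of a scalar: `f_{|k} := δf/δx^k = ∂f/∂x^k - N^l_k ∂f/∂y^l`. -/
def hD {n : ℕ} (G : Fin n → Vec n → Vec n → ℝ) (f : Vec n → Vec n → ℝ) (k : Fin n) :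
    Vec n → Vec n → ℝ :=
  fun x y => pdx f k x y - ∑ l, Nc G l k x y * pdy f l x y

/-- Horizontal covariant derivative `A_{j|m}` of a 1-form `A_j`. -/
def covD1 {n : ℕ} (G : Fin n → Vec n → Vec n → ℝ) (A : Fin n → Vec n → Vec n → ℝ)
    (j m : Fin n) : Vec n → Vec n → ℝ :=
  fun x y => hD G (A j) m x y - ∑ l, A l x y * Γc G l j m x y

/-- Horizontal covariant derivative `A^i_{j|m}` of a (1,1)-tensor `A^i_j`. -/
def covD11 {n : ℕ} (G : Fin n → Vec n → Vec n → ℝ)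
    (A : Fin n → Fin n → Vec n → Vec n → ℝ) (i j m : Fin n) : Vec n → Vec n → ℝ :=
  fun x y => hD G (A i j) m x y + ∑ l, A l j x y * Γc G i l m x y
    - ∑ l, A i l x y * Γc G l j m x y

/-- Horizontal covariant derivative `B^i_{jk|m}` of a (1,2)-tensor `B^i_{jk}`. -/
def covD12 {n : ℕ} (G : Fin n → Vec n → Vec n → ℝ)
    (B : Fin n → Fin n → Fin n → Vec n → Vec n → ℝ) (i j k m : Fin n) : Vec n → Vec n → ℝ :=
  fun x y => hD G (B i j k) m x y + ∑ l, B l j k x y * Γc G i l m x y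
    - ∑ l, B i l k x y * Γc G l j m x y - ∑ l, B i j l x y * Γc G l k m x y

/-- Riemann curvature `R^i_k`. -/
def Riem {n : ℕ} (G : Fin n → Vec n → Vec n → ℝ) (i k : Fin n) : Vec n → Vec n → ℝ :=
  fun x y => 2 * pdx (G i) k x y - ∑ j, y j * pdy (pdx (G i) j) k x y
    + 2 * ∑ j, G j x y * Γc G i j k x y - ∑ s, Nc G i s x y * Nc G s k x y

/-- Ricci scalar `R := R^m_m/(n-1)`. -/
def Ricci {n : ℕ} (G : Fin n → Vec n → Vec n → ℝ) : Vec n → Vec n → ℝ :=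
  fun x y => (∑ m, Riem G m m x y) / ((n : ℝ) - 1)

/-- The Weyl-type curvature `T^i_k := R^i_k - (R δ^i_k - ½ R_{·k} y^i)`. -/
def Tcurv {n : ℕ} (G : Fin n → Vec n → Vec n → ℝ) (i k : Fin n) : Vec n → Vec n → ℝ :=
  fun x y => Riem G i k x y -
    (Ricci G x y * (if i = k then 1 else 0) - (1/2) * pdy (Ricci G) k x y * y i)

/-- The χ-curvature `χ_i := -(1/3) T^m_{i·m}`. -/
def chiC {n : ℕ} (G : Fin n → Vec n → Vec n → ℝ) (i : Fin n) : Vec n → Vec n → ℝ :=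
  fun x y => -(1/3) * ∑ m, pdy (Tcurv G m i) m x y

/-- The Weyl curvature `W^i_k := T^i_k + (3χ_k/(n+1)) y^i`. -/
def Weyl {n : ℕ} (G : Fin n → Vec n → Vec n → ℝ) (i k : Fin n) : Vec n → Vec n → ℝ :=
  fun x y => Tcurv G i k x y + (3 * chiC G k x y / ((n : ℝ) + 1)) * y i

/-- A volume form `dV = σ(x) dx` on `U`: `σ` smooth and positive. -/
def IsVolumeForm {n : ℕ} (U : Set (Vec n)) (σ : Vec n → ℝ) : Prop :=
  ContDiffOn ℝ (⊤ : ℕ∞) σ U ∧ ∀ x ∈ U, 0 < σ x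

/-- The S-curvature of `(G, dV)`: `S := ∂G^m/∂y^m - y^m ∂(ln σ)/∂x^m`. -/
def Scurv {n : ℕ} (G : Fin n → Vec n → Vec n → ℝ) (σ : Vec n → ℝ) : Vec n → Vec n → ℝ :=
  fun x y => ∑ m, Nc G m m x y
    - ∑ m, y m * fderiv ℝ (fun x' => Real.log (σ x')) x (Pi.single m 1)

/-- The projective spray `Ĝ^i := G^i - (S/(n+1)) y^i` of `(G, dV)`. -/
def Ghat {n : ℕ} (G : Fin n → Vec n → Vec n → ℝ) (σ : Vec n → ℝ) :
    Fin n → Vec n → Vec n → ℝ :=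
  fun i x y => G i x y - (Scurv G σ x y / ((n : ℝ) + 1)) * y i

/-- The Berwald–Weyl curvature `W^o_k := R̂_{∥k} - ½ R̂_{·k∥m} y^m` of `(G, dV)`,
where all hatted quantities and `∥` are taken with respect to the projective spray `Ĝ`. -/
def BWeyl {n : ℕ} (G : Fin n → Vec n → Vec n → ℝ) (σ : Vec n → ℝ) (k : Fin n) :
    Vec n → Vec n → ℝ :=
  fun x y => hD (Ghat G σ) (Ricci (Ghat G σ)) k x y
    - (1/2) * ∑ m, covD1 (Ghat G σ) (fun j => pdy (Ricci (Ghat G σ)) j) k m x y * y m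

/-- The square `F²` of a Finsler metric. -/
def Fsq {n : ℕ} (F : Vec n → Vec n → ℝ) : Vec n → Vec n → ℝ := fun x y => (F x y) ^ 2

/-- The fundamental tensor `g_{ij}(x,y) := ½ ∂²(F²)/∂y^i∂y^j` as a matrix. -/
def gmat {n : ℕ} (F : Vec n → Vec n → ℝ) (x y : Vec n) : Matrix (Fin n) (Fin n) ℝ :=
  fun i j => (1/2) * pdy (pdy (Fsq F) i) j x y

/-- A Finsler metric on `U`: smooth and positive on `U × (ℝⁿ \ {0})`, positively
1-homogeneous in `y`, with positive definite fundamental tensor. -/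
def IsFinsler {n : ℕ} (U : Set (Vec n)) (F : Vec n → Vec n → ℝ) : Prop :=
  ContDiffOn ℝ (⊤ : ℕ∞) (fun p : Vec n × Vec n => F p.1 p.2) (U ×ˢ slit n) ∧
  (∀ x ∈ U, ∀ y ∈ slit n, 0 < F x y) ∧
  (∀ x ∈ U, ∀ y ∈ slit n, ∀ c : ℝ, 0 < c → F x (c • y) = c * F x y) ∧
  (∀ x ∈ U, ∀ y ∈ slit n, (gmat F x y).PosDef)

/-- The spray induced by a Finsler metric:
`G^i := ¼ g^{il}([F²]_{x^k y^l} y^k − [F²]_{x^l})`. -/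
def sprayF {n : ℕ} (F : Vec n → Vec n → ℝ) : Fin n → Vec n → Vec n → ℝ :=
  fun i x y => (1/4) * ∑ l, (gmat F x y)⁻¹ i l *
    (∑ k, y k * pdy (pdx (Fsq F) k) l x y - pdx (Fsq F) l x y)

/-- The Busemann–Hausdorff volume density
`σ_BH(x) := vol(Bⁿ) / vol {y | F(x,y) < 1}`. -/
def sigmaBH {n : ℕ} (F : Vec n → Vec n → ℝ) (x : Vec n) : ℝ :=
  (volume {y : Vec n | ∑ i, (y i) ^ 2 < 1}).toReal /
    (volume {y : Vec n | F x y < 1}).toReal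

section Calculus

variable {n : ℕ} {U : Set (Vec n)} {f g : Vec n → Vec n → ℝ} {x y : Vec n}

/-- Smoothness on the slit bundle `U × (ℝⁿ \ {0})`. -/
def SmoothSlit (U : Set (Vec n)) (f : Vec n → Vec n → ℝ) : Prop :=
  ContDiffOn ℝ (⊤ : ℕ∞) (fun p : Vec n × Vec n => f p.1 p.2) (U ×ˢ slit n)

/-- Positive `d`-homogeneity in the fibre variable on the slit bundle. -/
def HomSlit (U : Set (Vec n)) (d : ℕ) (f : Vec n → Vec n → ℝ) : Prop :=
  ∀ x ∈ U, ∀ y ∈ slit n, ∀ c : ℝ, 0 < c → f x (c • y) = c ^ d * f x y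

lemma isOpen_slit : IsOpen (slit n) := isOpen_ne

lemma smul_mem_slit (hy : y ∈ slit n) {c : ℝ} (hc : 0 < c) : c • y ∈ slit n :=
  smul_ne_zero hc.ne' hy

namespace SmoothSlit

lemma contDiffAt (hU : IsOpen U) (hf : SmoothSlit U f) (hx : x ∈ U) (hy : y ∈ slit n) :
    ContDiffAt ℝ (⊤ : ℕ∞) (fun p : Vec n × Vec n => f p.1 p.2) (x, y) :=
  ContDiffOn.contDiffAt hf ((hU.prod isOpen_slit).mem_nhds ⟨hx, hy⟩)

lemma contDiffAt_two (hU : IsOpen U) (hf : SmoothSlit U f) (hx : x ∈ U) (hy : y ∈ slit n) :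
    ContDiffAt ℝ 2 (fun p : Vec n × Vec n => f p.1 p.2) (x, y) :=
  (hf.contDiffAt hU hx hy).of_le (WithTop.coe_le_coe.2 (le_top : (2 : ℕ∞) ≤ ⊤))

lemma differentiableAt (hU : IsOpen U) (hf : SmoothSlit U f) (hx : x ∈ U) (hy : y ∈ slit n) :
    DifferentiableAt ℝ (fun p : Vec n × Vec n => f p.1 p.2) (x, y) :=
  (hf.contDiffAt hU hx hy).differentiableAt (by simp)

lemma differentiableAt_fst (hU : IsOpen U) (hf : SmoothSlit U f) (hx : x ∈ U)
    (hy : y ∈ slit n) : DifferentiableAt ℝ (fun x' => f x' y) x :=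
  DifferentiableAt.comp (g := fun p : Vec n × Vec n => f p.1 p.2)
    (f := fun x' => (x', y)) x
    (hf.differentiableAt hU hx hy) (differentiableAt_id.prodMk (differentiableAt_const y))

lemma differentiableAt_snd (hU : IsOpen U) (hf : SmoothSlit U f) (hx : x ∈ U)
    (hy : y ∈ slit n) : DifferentiableAt ℝ (fun y' => f x y') y :=
  DifferentiableAt.comp (g := fun p : Vec n × Vec n => f p.1 p.2)
    (f := fun y' => (x, y')) y
    (hf.differentiableAt hU hx hy) ((differentiableAt_const x).prodMk differentiableAt_id)

lemma pdx_eq (hU : IsOpen U) (hf : SmoothSlit U f) (hx : x ∈ U) (hy : y ∈ slit n) (i : Fin n) :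
    pdx f i x y =
      fderiv ℝ (fun p : Vec n × Vec n => f p.1 p.2) (x, y) (Pi.single i 1, 0) := by
  have h := HasFDerivAt.comp (g := fun p : Vec n × Vec n => f p.1 p.2)
    (f := fun x' => (x', y)) x
    (hf.differentiableAt hU hx hy).hasFDerivAt ((hasFDerivAt_id x).prodMk (hasFDerivAt_const y x))
  exact congrArg (fun T => T (Pi.single i 1)) h.fderiv

lemma pdy_eq (hU : IsOpen U) (hf : SmoothSlit U f) (hx : x ∈ U) (hy : y ∈ slit n) (i : Fin n) :
    pdy f i x y =
      fderiv ℝ (fun p : Vec n × Vec n => f p.1 p.2) (x, y) (0, Pi.single i 1) := by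
  have h := HasFDerivAt.comp (g := fun p : Vec n × Vec n => f p.1 p.2)
    (f := fun y' => (x, y')) y
    (hf.differentiableAt hU hx hy).hasFDerivAt ((hasFDerivAt_const x y).prodMk (hasFDerivAt_id y))
  exact congrArg (fun T => T (Pi.single i 1)) h.fderiv

lemma fderiv_apply (hU : IsOpen U) (hf : SmoothSlit U f) (v : Vec n × Vec n) :
    ContDiffOn ℝ (⊤ : ℕ∞)
      (fun p => fderiv ℝ (fun p : Vec n × Vec n => f p.1 p.2) p v) (U ×ˢ slit n) :=
  (ContDiffOn.fderiv_of_isOpen hf (hU.prod isOpen_slit) (by simp)).clm_apply contDiffOn_const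

lemma pdx (hU : IsOpen U) (hf : SmoothSlit U f) (i : Fin n) : SmoothSlit U (pdx f i) :=
  (hf.fderiv_apply hU (Pi.single i 1, 0)).congr fun _ hp => hf.pdx_eq hU hp.1 hp.2 i

lemma pdy (hU : IsOpen U) (hf : SmoothSlit U f) (i : Fin n) : SmoothSlit U (pdy f i) :=
  (hf.fderiv_apply hU (0, Pi.single i 1)).congr fun _ hp => hf.pdy_eq hU hp.1 hp.2 i

lemma add (hf : SmoothSlit U f) (hg : SmoothSlit U g) :
    SmoothSlit U (fun x y => f x y + g x y) := ContDiffOn.add hf hg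

lemma sub (hf : SmoothSlit U f) (hg : SmoothSlit U g) :
    SmoothSlit U (fun x y => f x y - g x y) := ContDiffOn.sub hf hg

lemma mul (hf : SmoothSlit U f) (hg : SmoothSlit U g) :
    SmoothSlit U (fun x y => f x y * g x y) := ContDiffOn.mul hf hg

lemma sum {ι : Type*} {s : Finset ι} {h : ι → Vec n → Vec n → ℝ}
    (hh : ∀ i, SmoothSlit U (h i)) : SmoothSlit U (fun x y => ∑ i ∈ s, h i x y) :=
  ContDiffOn.sum fun i _ => hh i

lemma prod {ι : Type*} {s : Finset ι} {h : ι → Vec n → Vec n → ℝ}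
    (hh : ∀ i, SmoothSlit U (h i)) : SmoothSlit U (fun x y => ∏ i ∈ s, h i x y) :=
  contDiffOn_prod fun i _ => hh i

lemma const (a : ℝ) : SmoothSlit U (fun _ _ => a) := contDiffOn_const

lemma coord (i : Fin n) : SmoothSlit U (fun _ y => y i) :=
  ((contDiff_apply ℝ ℝ i).comp contDiff_snd).contDiffOn

lemma base {s : Vec n → ℝ} (hs : ContDiffOn ℝ (⊤ : ℕ∞) s U) : SmoothSlit U (fun x _ => s x) :=
  hs.comp contDiffOn_fst fun _ hp => hp.1

lemma det {A : Vec n → Vec n → Matrix (Fin n) (Fin n) ℝ}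
    (hA : ∀ i j, SmoothSlit U fun x y => A x y i j) : SmoothSlit U fun x y => (A x y).det := by
  simp only [Matrix.det_apply']
  exact sum fun s => (const _).mul (prod fun i => hA _ _)

lemma matrix_inv {A : Vec n → Vec n → Matrix (Fin n) (Fin n) ℝ}
    (hA : ∀ i j, SmoothSlit U fun x y => A x y i j)
    (h0 : ∀ x ∈ U, ∀ y ∈ slit n, (A x y).det ≠ 0) (i j : Fin n) :
    SmoothSlit U fun x y => (A x y)⁻¹ i j := by
  simp only [Matrix.inv_def, Ring.inverse_eq_inv', Matrix.smul_apply, smul_eq_mul,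
    Matrix.adjugate_apply]
  refine mul (ContDiffOn.inv (det hA) fun p hp => h0 _ hp.1 _ hp.2) (det fun a b => ?_)
  by_cases h : a = j
  · subst h
    simpa using const _
  · simpa [Matrix.updateRow_ne h] using hA a b

end SmoothSlit

lemma pdx_congr (hU : IsOpen U) (h : ∀ x ∈ U, ∀ y ∈ slit n, f x y = g x y)
    (hx : x ∈ U) (hy : y ∈ slit n) (i : Fin n) : pdx f i x y = pdx g i x y := by
  have : (fun x' => f x' y) =ᶠ[nhds x] fun x' => g x' y :=
    Filter.eventually_of_mem (hU.mem_nhds hx) fun x' hx' => h x' hx' y hy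
  simp only [pdx, this.fderiv_eq]

lemma pdy_congr (h : ∀ x ∈ U, ∀ y ∈ slit n, f x y = g x y)
    (hx : x ∈ U) (hy : y ∈ slit n) (i : Fin n) : pdy f i x y = pdy g i x y := by
  have : (fun y' => f x y') =ᶠ[nhds y] fun y' => g x y' :=
    Filter.eventually_of_mem (isOpen_slit.mem_nhds hy) fun y' hy' => h x hx y' hy'
  simp only [pdy, this.fderiv_eq]

lemma pdx_add (hU : IsOpen U) (hf : SmoothSlit U f) (hg : SmoothSlit U g)
    (hx : x ∈ U) (hy : y ∈ slit n) (i : Fin n) :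
    pdx (fun x y => f x y + g x y) i x y = pdx f i x y + pdx g i x y := by
  simp only [pdx]
  rw [fderiv_fun_add (hf.differentiableAt_fst hU hx hy) (hg.differentiableAt_fst hU hx hy)]
  rfl

lemma pdy_add (hU : IsOpen U) (hf : SmoothSlit U f) (hg : SmoothSlit U g)
    (hx : x ∈ U) (hy : y ∈ slit n) (i : Fin n) :
    pdy (fun x y => f x y + g x y) i x y = pdy f i x y + pdy g i x y := by
  simp only [pdy]
  rw [fderiv_fun_add (hf.differentiableAt_snd hU hx hy) (hg.differentiableAt_snd hU hx hy)]
  rfl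

lemma pdy_sub (hU : IsOpen U) (hf : SmoothSlit U f) (hg : SmoothSlit U g)
    (hx : x ∈ U) (hy : y ∈ slit n) (i : Fin n) :
    pdy (fun x y => f x y - g x y) i x y = pdy f i x y - pdy g i x y := by
  simp only [pdy]
  rw [fderiv_fun_sub (hf.differentiableAt_snd hU hx hy) (hg.differentiableAt_snd hU hx hy)]
  rfl

lemma pdx_mul (hU : IsOpen U) (hf : SmoothSlit U f) (hg : SmoothSlit U g)
    (hx : x ∈ U) (hy : y ∈ slit n) (i : Fin n) :
    pdx (fun x y => f x y * g x y) i x y = pdx f i x y * g x y + f x y * pdx g i x y := by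
  simp only [pdx]
  rw [fderiv_fun_mul (hf.differentiableAt_fst hU hx hy) (hg.differentiableAt_fst hU hx hy)]
  simp
  ring

lemma pdy_mul (hU : IsOpen U) (hf : SmoothSlit U f) (hg : SmoothSlit U g)
    (hx : x ∈ U) (hy : y ∈ slit n) (i : Fin n) :
    pdy (fun x y => f x y * g x y) i x y = pdy f i x y * g x y + f x y * pdy g i x y := by
  simp only [pdy]
  rw [fderiv_fun_mul (hf.differentiableAt_snd hU hx hy) (hg.differentiableAt_snd hU hx hy)]
  simp
  ring

lemma pdy_sum (hU : IsOpen U) {ι : Type*} {s : Finset ι} {h : ι → Vec n → Vec n → ℝ}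
    (hh : ∀ i, SmoothSlit U (h i)) (hx : x ∈ U) (hy : y ∈ slit n) (k : Fin n) :
    pdy (fun x y => ∑ i ∈ s, h i x y) k x y = ∑ i ∈ s, pdy (h i) k x y := by
  simp only [pdy]
  rw [fderiv_fun_sum fun i _ => (hh i).differentiableAt_snd hU hx hy]
  simp

@[simp] lemma pdx_fibre (s : Vec n → ℝ) (i : Fin n) (x y : Vec n) :
    pdx (fun _ y => s y) i x y = 0 := by
  simp [pdx]

@[simp] lemma pdy_base (s : Vec n → ℝ) (i : Fin n) (x y : Vec n) :
    pdy (fun x _ => s x) i x y = 0 := by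
  simp [pdy]

lemma pdy_coord (i k : Fin n) (x y : Vec n) :
    pdy (fun _ y => y i) k x y = if i = k then 1 else 0 := by
  have : HasFDerivAt (fun y' : Vec n => y' i) (ContinuousLinearMap.proj i : Vec n →L[ℝ] ℝ) y :=
    (ContinuousLinearMap.proj i : Vec n →L[ℝ] ℝ).hasFDerivAt
  simp [pdy, this.fderiv, Pi.single_apply]

lemma fderiv_fderiv_apply {E : Type*} [NormedAddCommGroup E] [NormedSpace ℝ E] {h : E → ℝ}
    {p : E} (hh : ContDiffAt ℝ 2 h p) (v w : E) :
    fderiv ℝ (fun q => fderiv ℝ h q v) p w = fderiv ℝ (fderiv ℝ h) p w v := by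
  have : DifferentiableAt ℝ (fderiv ℝ h) p :=
    (hh.fderiv_right (m := 1) (by norm_num)).differentiableAt (by simp)
  rw [fderiv_clm_apply this (differentiableAt_const v)]
  simp

lemma fderiv_fderiv_comm {E : Type*} [NormedAddCommGroup E] [NormedSpace ℝ E] {h : E → ℝ}
    {p : E} (hh : ContDiffAt ℝ 2 h p) (v w : E) :
    fderiv ℝ (fun q => fderiv ℝ h q v) p w = fderiv ℝ (fun q => fderiv ℝ h q w) p v := by
  rw [fderiv_fderiv_apply hh, fderiv_fderiv_apply hh]
  exact (hh.isSymmSndFDerivAt (by simp)).eq w v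

lemma pdy_pdy_comm (hU : IsOpen U) (hf : SmoothSlit U f) (hx : x ∈ U) (hy : y ∈ slit n)
    (i j : Fin n) : pdy (pdy f i) j x y = pdy (pdy f j) i x y :=
  fderiv_fderiv_comm (ContDiffAt.comp (g := fun p : Vec n × Vec n => f p.1 p.2)
    (f := fun y' => (x, y')) y (hf.contDiffAt_two hU hx hy)
    (contDiffAt_const.prodMk contDiffAt_id)) _ _

lemma pdx_pdy_comm (hU : IsOpen U) (hf : SmoothSlit U f) (hx : x ∈ U) (hy : y ∈ slit n)
    (i j : Fin n) : pdx (pdy f i) j x y = pdy (pdx f j) i x y := by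
  have key := fderiv_fderiv_comm (hf.contDiffAt_two hU hx hy)
    (0, Pi.single i 1) (Pi.single j 1, 0)
  rw [(hf.pdy hU i).pdx_eq hU hx hy, (hf.pdx hU j).pdy_eq hU hx hy]
  have hnhds := (hU.prod isOpen_slit).mem_nhds (⟨hx, hy⟩ : (x, y) ∈ U ×ˢ slit n)
  have h1 : (fun p : Vec n × Vec n => pdy f i p.1 p.2) =ᶠ[nhds (x, y)] _ :=
    Filter.eventually_of_mem hnhds fun p hp => hf.pdy_eq hU hp.1 hp.2 i
  have h2 : (fun p : Vec n × Vec n => pdx f j p.1 p.2) =ᶠ[nhds (x, y)] _ :=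
    Filter.eventually_of_mem hnhds fun p hp => hf.pdx_eq hU hp.1 hp.2 j
  rw [h1.fderiv_eq, h2.fderiv_eq]
  exact key

namespace HomSlit

variable {d : ℕ}

lemma euler (hU : IsOpen U) (hs : SmoothSlit U f) (hf : HomSlit U d f)
    (hx : x ∈ U) (hy : y ∈ slit n) : ∑ k, pdy f k x y * y k = d * f x y := by
  have hd := hs.differentiableAt_snd hU hx hy
  have h1 : HasDerivAt (fun t : ℝ => f x (t • y)) (fderiv ℝ (fun y' => f x y') y y) 1 := by
    have hl : HasDerivAt (fun t : ℝ => t • y) y 1 := by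
      simpa using (hasDerivAt_id (1 : ℝ)).smul_const y
    have hd' : HasFDerivAt (fun y' => f x y') (fderiv ℝ (fun y' => f x y') y) ((1 : ℝ) • y) := by
      simpa using hd.hasFDerivAt
    exact hd'.comp_hasDerivAt 1 hl
  have h2 : HasDerivAt (fun t : ℝ => t ^ d * f x y) (d * f x y) 1 := by
    simpa using (hasDerivAt_pow d (1 : ℝ)).mul_const (f x y)
  have h3 : (fun t : ℝ => f x (t • y)) =ᶠ[nhds 1] fun t => t ^ d * f x y :=
    Filter.eventually_of_mem (Ioi_mem_nhds one_pos) fun t ht => hf x hx y hy t ht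
  rw [← h1.unique (h2.congr_of_eventuallyEq h3)]
  conv_rhs => arg 2; rw [← Finset.univ_sum_single y]
  rw [map_sum]
  refine Finset.sum_congr rfl fun k _ => ?_
  have : (Pi.single k (y k) : Vec n) = y k • Pi.single k 1 := by
    rw [← Pi.single_smul, smul_eq_mul, mul_one]
  rw [this, map_smul, smul_eq_mul, mul_comm]
  simp [_root_.pdy]

lemma pdy (hU : IsOpen U) (hs : SmoothSlit U f) (hf : HomSlit U (d + 1) f) (k : Fin n) :
    HomSlit U d (pdy f k) := by
  intro x hx y hy c hc
  have hd := hs.differentiableAt_snd hU hx (smul_mem_slit hy hc)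
  have h1 : HasFDerivAt (fun y' => f x (c • y'))
      ((fderiv ℝ (fun y' => f x y') (c • y)).comp (c • ContinuousLinearMap.id ℝ (Vec n))) y :=
    hd.hasFDerivAt.comp y ((hasFDerivAt_id y).const_smul c)
  have h2 : HasFDerivAt (fun y' => c ^ (d + 1) * f x y')
      (c ^ (d + 1) • fderiv ℝ (fun y' => f x y') y) y :=
    (hs.differentiableAt_snd hU hx hy).hasFDerivAt.const_mul _
  have h3 : (fun y' => f x (c • y')) =ᶠ[nhds y] fun y' => c ^ (d + 1) * f x y' :=
    Filter.eventually_of_mem (isOpen_slit.mem_nhds hy) fun y' hy' => hf x hx y' hy' c hc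
  have h4 := congrArg (fun T => T (Pi.single k 1)) (h1.unique (h2.congr_of_eventuallyEq h3))
  simp only [ContinuousLinearMap.comp_apply, _root_.smul_apply,
    ContinuousLinearMap.id_apply, map_smul, smul_eq_mul, pow_succ] at h4
  apply mul_left_cancel₀ hc.ne'
  simp only [_root_.pdy]
  linarith

lemma pdx (hU : IsOpen U) (hs : SmoothSlit U f) (hf : HomSlit U d f) (k : Fin n) :
    HomSlit U d (pdx f k) := by
  intro x hx y hy c hc
  have h3 : (fun x' => f x' (c • y)) =ᶠ[nhds x] fun x' => c ^ d * f x' y :=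
    Filter.eventually_of_mem (hU.mem_nhds hx) fun x' hx' => hf x' hx' y hy c hc
  simp only [_root_.pdx]
  rw [h3.fderiv_eq, fderiv_const_mul (hs.differentiableAt_fst hU hx hy)]
  simp

end HomSlit

lemma pdy_add_mul_coord (hU : IsOpen U) (hf : SmoothSlit U f) (hg : SmoothSlit U g)
    (hx : x ∈ U) (hy : y ∈ slit n) (i k : Fin n) :
    pdy (fun x y => f x y + g x y * y i) k x y =
      pdy f k x y + (pdy g k x y * y i + g x y * if i = k then 1 else 0) := by
  rw [pdy_add hU hf (hg.mul (.coord i)) hx hy, pdy_mul hU hg (.coord i) hx hy, pdy_coord]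

lemma pdx_add_mul_coord (hU : IsOpen U) (hf : SmoothSlit U f) (hg : SmoothSlit U g)
    (hx : x ∈ U) (hy : y ∈ slit n) (i k : Fin n) :
    pdx (fun x y => f x y + g x y * y i) k x y = pdx f k x y + pdx g k x y * y i := by
  rw [pdx_add hU hf (hg.mul (.coord i)) hx hy, pdx_mul hU hg (.coord i) hx hy,
    pdx_fibre, mul_zero, add_zero]

lemma pdy_sum_mul_coord (hU : IsOpen U) {h : Fin n → Vec n → Vec n → ℝ}
    (hh : ∀ i, SmoothSlit U (h i)) (hx : x ∈ U) (hy : y ∈ slit n) (k : Fin n) :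
    pdy (fun x y => ∑ m, h m x y * y m) k x y = ∑ m, pdy (h m) k x y * y m + h k x y := by
  rw [pdy_sum hU (fun m => (hh m).mul (.coord m)) hx hy]
  simp only [pdy_mul hU (hh _) (.coord _) hx hy, pdy_coord, Finset.sum_add_distrib,
    mul_ite, mul_one, mul_zero, Finset.sum_ite_eq', Finset.mem_univ, if_true]

end Calculus

section Spray

variable {n : ℕ} {U : Set (Vec n)} {G H : Fin n → Vec n → Vec n → ℝ} {f : Vec n → Vec n → ℝ}
  {x y : Vec n}

namespace IsSpray

lemma smooth (hG : IsSpray U G) (i : Fin n) : SmoothSlit U (G i) := hG.1 i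

lemma hom (hG : IsSpray U G) (i : Fin n) : HomSlit U 2 (G i) := hG.2 i

lemma smooth_Nc (hU : IsOpen U) (hG : IsSpray U G) (i j : Fin n) : SmoothSlit U (Nc G i j) :=
  (hG.smooth i).pdy hU j

lemma sum_Nc_mul (hU : IsOpen U) (hG : IsSpray U G) (hx : x ∈ U) (hy : y ∈ slit n) (i : Fin n) :
    ∑ k, Nc G i k x y * y k = 2 * G i x y := by
  simpa [Nc] using HomSlit.euler hU (hG.smooth i) (hG.hom i) hx hy

lemma sum_Γc_mul (hU : IsOpen U) (hG : IsSpray U G) (hx : x ∈ U) (hy : y ∈ slit n)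
    (i j : Fin n) : ∑ k, Γc G i j k x y * y k = Nc G i j x y :=
  (HomSlit.euler (d := 1) hU (hG.smooth_Nc hU i j)
    (HomSlit.pdy hU (hG.smooth i) (hG.hom i) j) hx hy).trans (by simp)

lemma Γc_symm (hU : IsOpen U) (hG : IsSpray U G) (hx : x ∈ U) (hy : y ∈ slit n)
    (i j k : Fin n) : Γc G i j k x y = Γc G i k j x y :=
  pdy_pdy_comm hU (hG.smooth i) hx hy j k

lemma smooth_hD (hU : IsOpen U) (hG : IsSpray U G) (hf : SmoothSlit U f) (k : Fin n) :
    SmoothSlit U (hD G f k) :=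
  (hf.pdx hU k).sub (.sum fun l => (hG.smooth_Nc hU l k).mul (hf.pdy hU l))

end IsSpray

section Congr

variable {U : Set (Vec n)} {f g : Vec n → Vec n → ℝ}

lemma Nc_congr (h : ∀ i, ∀ x ∈ U, ∀ y ∈ slit n, G i x y = H i x y)
    (hx : x ∈ U) (hy : y ∈ slit n) (i j : Fin n) : Nc G i j x y = Nc H i j x y :=
  pdy_congr (h i) hx hy j

lemma Γc_congr (h : ∀ i, ∀ x ∈ U, ∀ y ∈ slit n, G i x y = H i x y)
    (hx : x ∈ U) (hy : y ∈ slit n) (i j k : Fin n) : Γc G i j k x y = Γc H i j k x y :=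
  pdy_congr (fun _ hx _ hy => Nc_congr h hx hy i j) hx hy k

lemma hD_congr (hU : IsOpen U) (h : ∀ i, ∀ x ∈ U, ∀ y ∈ slit n, G i x y = H i x y)
    (hfg : ∀ x ∈ U, ∀ y ∈ slit n, f x y = g x y) (hx : x ∈ U) (hy : y ∈ slit n) (k : Fin n) :
    hD G f k x y = hD H g k x y := by
  simp only [hD, pdx_congr hU hfg hx hy, pdy_congr hfg hx hy, Nc_congr h hx hy]

lemma Riem_congr (hU : IsOpen U) (h : ∀ i, ∀ x ∈ U, ∀ y ∈ slit n, G i x y = H i x y)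
    (hx : x ∈ U) (hy : y ∈ slit n) (i k : Fin n) : Riem G i k x y = Riem H i k x y := by
  have h1 (j : Fin n) : pdy (pdx (G i) j) k x y = pdy (pdx (H i) j) k x y :=
    pdy_congr (fun _ hx _ hy => pdx_congr hU (h i) hx hy j) hx hy k
  simp only [Riem, pdx_congr hU (h i) hx hy, h1, Nc_congr h hx hy, Γc_congr h hx hy,
    h _ x hx y hy]

lemma covD1_congr (hU : IsOpen U) (h : ∀ i, ∀ x ∈ U, ∀ y ∈ slit n, G i x y = H i x y)
    {A B : Fin n → Vec n → Vec n → ℝ} (hAB : ∀ i, ∀ x ∈ U, ∀ y ∈ slit n, A i x y = B i x y)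
    (hx : x ∈ U) (hy : y ∈ slit n) (j m : Fin n) : covD1 G A j m x y = covD1 H B j m x y := by
  simp only [covD1, hD_congr hU h (hAB j) hx hy, Γc_congr h hx hy, hAB _ x hx y hy]

end Congr

/-- Horizontal and vertical derivatives of a scalar commute. -/
lemma covD1_pdy (hU : IsOpen U) (hG : IsSpray U G) (hf : SmoothSlit U f)
    (hx : x ∈ U) (hy : y ∈ slit n) (k m : Fin n) :
    covD1 G (fun j => pdy f j) k m x y = pdy (hD G f m) k x y := by
  have hNf (l : Fin n) : SmoothSlit U (fun x y => Nc G l m x y * pdy f l x y) :=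
    (hG.smooth_Nc hU l m).mul (hf.pdy hU l)
  have h : pdy (hD G f m) k x y = pdy (pdx f m) k x y
      - ∑ l, (Γc G l m k x y * pdy f l x y + Nc G l m x y * pdy (pdy f l) k x y) := by
    rw [show hD G f m = fun x y => pdx f m x y - ∑ l, Nc G l m x y * pdy f l x y from rfl,
      pdy_sub hU (hf.pdx hU m) (.sum hNf) hx hy, pdy_sum hU hNf hx hy]
    simp only [pdy_mul hU (hG.smooth_Nc hU _ m) (hf.pdy hU _) hx hy]
    rfl
  rw [h, Finset.sum_add_distrib]
  simp only [covD1, hD, pdx_pdy_comm hU hf hx hy, pdy_pdy_comm hU hf hx hy k,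
    hG.Γc_symm hU hx hy _ k m, mul_comm (pdy f _ x y)]
  ring

/-- The contraction of the Hessian-type term in the Berwald–Weyl curvature. -/
lemma sum_covD1_pdy_mul (hU : IsOpen U) (hG : IsSpray U G) (hf : SmoothSlit U f)
    (hx : x ∈ U) (hy : y ∈ slit n) (k : Fin n) :
    ∑ m, covD1 G (fun j => pdy f j) k m x y * y m =
      pdy (fun x y => ∑ m, hD G f m x y * y m) k x y - hD G f k x y := by
  rw [pdy_sum_mul_coord hU (fun m => hG.smooth_hD hU hf m) hx hy]
  simp only [covD1_pdy hU hG hf hx hy]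
  ring

section ProjectiveChange

variable {P : Vec n → Vec n → ℝ}

lemma IsSpray.projective (hG : IsSpray U G) (hP : SmoothSlit U P) (hP1 : HomSlit U 1 P) :
    IsSpray U (fun i x y => G i x y + P x y * y i) :=
  ⟨fun i => (hG.smooth i).add (hP.mul (.coord i)), fun i x hx y hy c hc => by
    simp only [hG.hom i x hx y hy c hc, hP1 x hx y hy c hc, Pi.smul_apply, smul_eq_mul]
    ring⟩

lemma Nc_projective (hU : IsOpen U) (hG : IsSpray U G) (hP : SmoothSlit U P)
    (hx : x ∈ U) (hy : y ∈ slit n) (i k : Fin n) :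
    Nc (fun i x y => G i x y + P x y * y i) i k x y =
      Nc G i k x y + (pdy P k x y * y i + P x y * if i = k then 1 else 0) :=
  pdy_add_mul_coord hU (hG.smooth i) hP hx hy i k

lemma Γc_projective (hU : IsOpen U) (hG : IsSpray U G) (hP : SmoothSlit U P)
    (hx : x ∈ U) (hy : y ∈ slit n) (i j k : Fin n) :
    Γc (fun i x y => G i x y + P x y * y i) i j k x y =
      Γc G i j k x y + pdy P k x y * (if i = j then 1 else 0)
        + (pdy (pdy P j) k x y * y i + pdy P j x y * if i = k then 1 else 0) := by
  have hc : SmoothSlit U (fun _ _ => if i = j then (1 : ℝ) else 0) := .const _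
  have h := pdy_congr (f := Nc (fun i x y => G i x y + P x y * y i) i j) (g := fun x y =>
    (Nc G i j x y + P x y * if i = j then 1 else 0) + pdy P j x y * y i)
    (fun x hx y hy => by rw [Nc_projective hU hG hP hx hy i j]; ring) hx hy k
  refine h.trans ?_
  rw [pdy_add_mul_coord hU ((hG.smooth_Nc hU i j).add (hP.mul hc)) (hP.pdy hU j) hx hy,
    pdy_add hU (hG.smooth_Nc hU i j) (hP.mul hc) hx hy, pdy_mul hU hP hc hx hy,
    pdy_base (fun _ => if i = j then (1 : ℝ) else 0)]
  simp [Γc, Nc]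

/-- Transformation of the Ricci curvature under the projective change `G^i ↦ G^i + P y^i`. -/
theorem sum_Riem_projective (hU : IsOpen U) (hG : IsSpray U G) (hP : SmoothSlit U P)
    (hP1 : HomSlit U 1 P) (hx : x ∈ U) (hy : y ∈ slit n) :
    ∑ m, Riem (fun i x y => G i x y + P x y * y i) m m x y = ∑ m, Riem G m m x y
      + ((n : ℝ) - 1) * (P x y ^ 2 - ∑ k, pdx P k x y * y k
        + 2 * ∑ k, G k x y * pdy P k x y) := by
  have eP : ∑ k, pdy P k x y * y k = P x y := by simpa using HomSlit.euler hU hP hP1 hx hy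
  have ePx (j : Fin n) : ∑ k, pdy (pdx P j) k x y * y k = pdx P j x y := by
    simpa using HomSlit.euler hU (hP.pdx hU j) (HomSlit.pdx hU hP hP1 j) hx hy
  have ePy (j : Fin n) : ∑ k, pdy (pdy P j) k x y * y k = 0 := by
    simpa using HomSlit.euler hU (hP.pdy hU j) (HomSlit.pdy (d := 0) hU hP hP1 j) hx hy
  have eN := hG.sum_Nc_mul hU hx hy
  have eΓ : ∑ j, y j * ∑ m, Γc G m j m x y = ∑ m, Nc G m m x y := by
    simp only [Finset.mul_sum]
    rw [Finset.sum_comm]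
    refine Finset.sum_congr rfl fun m _ => ?_
    rw [← hG.sum_Γc_mul hU hx hy m m]
    exact Finset.sum_congr rfl fun j _ => by rw [hG.Γc_symm hU hx hy m j m, mul_comm]
  set Q : Fin n → Vec n → Vec n → ℝ := fun i x y => G i x y + P x y * y i with hQ
  have h1 : ∑ m, pdx (Q m) m x y = ∑ m, pdx (G m) m x y + ∑ m, pdx P m x y * y m := by
    rw [← Finset.sum_add_distrib]
    exact Finset.sum_congr rfl fun m _ => pdx_add_mul_coord hU (hG.smooth m) hP hx hy m m
  have h2 : ∑ m, ∑ j, y j * pdy (pdx (Q m) j) m x y =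
      ∑ m, ∑ j, y j * pdy (pdx (G m) j) m x y + ((n : ℝ) + 1) * ∑ j, pdx P j x y * y j := by
    have key (m j : Fin n) : pdy (pdx (Q m) j) m x y = pdy (pdx (G m) j) m x y
        + (pdy (pdx P j) m x y * y m + pdx P j x y) := by
      have h := pdy_congr (fun x hx y hy =>
        pdx_add_mul_coord hU (hG.smooth m) hP hx hy m j) hx hy m
      rw [pdy_add_mul_coord hU ((hG.smooth m).pdx hU j) (hP.pdx hU j) hx hy] at h
      simpa using h
    rw [Finset.sum_comm, Finset.sum_comm (f := fun m j => y j * pdy (pdx (G m) j) m x y),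
      Finset.mul_sum, ← Finset.sum_add_distrib]
    refine Finset.sum_congr rfl fun j _ => ?_
    simp only [← Finset.mul_sum, key, Finset.sum_add_distrib, ePx, Finset.sum_const,
      Finset.card_univ, Fintype.card_fin, nsmul_eq_mul]
    ring
  have h3 : ∑ m, ∑ j, Q j x y * Γc Q m j m x y =
      ∑ m, ∑ j, G j x y * Γc G m j m x y + ((n : ℝ) + 1) * ∑ j, G j x y * pdy P j x y
        + P x y * ∑ m, Nc G m m x y + ((n : ℝ) + 1) * P x y ^ 2 := by
    have key (j : Fin n) : ∑ m, Γc Q m j m x y =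
        ∑ m, Γc G m j m x y + ((n : ℝ) + 1) * pdy P j x y := by
      simp only [hQ, Γc_projective hU hG hP hx hy, Finset.sum_add_distrib, ePy]
      simp
      ring
    have e : ((n : ℝ) + 1) * P x y ^ 2 = ((n : ℝ) + 1) * P x y * ∑ k, pdy P k x y * y k := by
      rw [eP]; ring
    rw [Finset.sum_comm, Finset.sum_comm (f := fun m j => G j x y * Γc G m j m x y), ← eΓ, e]
    simp only [← Finset.mul_sum, key]
    simp only [Finset.mul_sum (s := Finset.univ) (a := P x y),
      Finset.mul_sum (s := Finset.univ) (a := (n : ℝ) + 1),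
      Finset.mul_sum (s := Finset.univ) (a := ((n : ℝ) + 1) * P x y), ← Finset.sum_add_distrib]
    exact Finset.sum_congr rfl fun j _ => by simp only [hQ]; ring
  have h4 : ∑ m, ∑ s, Nc Q m s x y * Nc Q s m x y =
      ∑ m, ∑ s, Nc G m s x y * Nc G s m x y + 4 * ∑ j, G j x y * pdy P j x y
        + 2 * P x y * ∑ m, Nc G m m x y + ((n : ℝ) + 3) * P x y ^ 2 := by
    have key (m : Fin n) : ∑ s, Nc Q m s x y * Nc Q s m x y =
        ∑ s, Nc G m s x y * Nc G s m x y + 2 * (G m x y * pdy P m x y)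
          + ∑ s, pdy P s x y * (Nc G s m x y * y m) + 2 * P x y * Nc G m m x y
          + 3 * P x y * (pdy P m x y * y m) + P x y ^ 2 := by
      have expand (s : Fin n) : Nc Q m s x y * Nc Q s m x y =
          Nc G m s x y * Nc G s m x y + pdy P m x y * (Nc G m s x y * y s)
            + pdy P s x y * (Nc G s m x y * y m)
            + pdy P m x y * y m * (pdy P s x y * y s)
            + (if m = s then 2 * P x y * Nc G m m x y + 2 * P x y * (pdy P m x y * y m)
                + P x y ^ 2 else 0) := by
        simp only [hQ, Nc_projective hU hG hP hx hy]
        by_cases h : m = s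
        · subst h; simp; ring
        · simp [h, Ne.symm h]; ring
      simp only [expand, Finset.sum_add_distrib, ← Finset.mul_sum, eN, eP, Finset.sum_ite_eq,
        Finset.mem_univ, if_true]
      ring
    have e : ∑ m, ∑ s, pdy P s x y * (Nc G s m x y * y m) =
        2 * ∑ j, G j x y * pdy P j x y := by
      rw [Finset.sum_comm, Finset.mul_sum]
      refine Finset.sum_congr rfl fun s _ => ?_
      rw [← Finset.mul_sum, eN]
      ring
    simp only [key, Finset.sum_add_distrib, e, ← Finset.mul_sum, eP, Finset.sum_const,
      Finset.card_univ, Fintype.card_fin, nsmul_eq_mul]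
    ring
  simp only [Riem, Finset.sum_add_distrib, Finset.sum_sub_distrib, ← Finset.mul_sum]
  simp only [h1, h2, h3, h4]
  ring

end ProjectiveChange

end Spray

section Finsler

variable {n : ℕ} {U : Set (Vec n)} {F : Vec n → Vec n → ℝ} {x y : Vec n}

namespace IsFinsler

lemma smooth (hF : IsFinsler U F) : SmoothSlit U F := hF.1

lemma pos (hF : IsFinsler U F) (hx : x ∈ U) (hy : y ∈ slit n) : 0 < F x y := hF.2.1 x hx y hy

lemma hom (hF : IsFinsler U F) : HomSlit U 1 F := fun x hx y hy c hc => by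
  simpa using hF.2.2.1 x hx y hy c hc

lemma smooth_Fsq (hF : IsFinsler U F) : SmoothSlit U (Fsq F) := ContDiffOn.pow hF.1 2

lemma hom_Fsq (hF : IsFinsler U F) : HomSlit U 2 (Fsq F) := fun x hx y hy c hc => by
  simp only [Fsq, hF.2.2.1 x hx y hy c hc]
  ring

lemma pdy_Fsq (hU : IsOpen U) (hF : IsFinsler U F) (hx : x ∈ U) (hy : y ∈ slit n) (k : Fin n) :
    pdy (Fsq F) k x y = 2 * F x y * pdy F k x y := by
  rw [show Fsq F = fun x y => F x y * F x y by ext; simp [Fsq, sq],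
    pdy_mul hU hF.smooth hF.smooth hx hy]
  ring

lemma pdx_Fsq (hU : IsOpen U) (hF : IsFinsler U F) (hx : x ∈ U) (hy : y ∈ slit n) (k : Fin n) :
    pdx (Fsq F) k x y = 2 * F x y * pdx F k x y := by
  rw [show Fsq F = fun x y => F x y * F x y by ext; simp [Fsq, sq],
    pdx_mul hU hF.smooth hF.smooth hx hy]
  ring

lemma smooth_gmat (hU : IsOpen U) (hF : IsFinsler U F) (i j : Fin n) :
    SmoothSlit U (fun x y => gmat F x y i j) :=
  (SmoothSlit.const _).mul ((hF.smooth_Fsq.pdy hU i).pdy hU j)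

lemma det_gmat_ne_zero (hF : IsFinsler U F) (hx : x ∈ U) (hy : y ∈ slit n) :
    (gmat F x y).det ≠ 0 := (hF.2.2.2 x hx y hy).det_pos.ne'

lemma gmat_smul (hU : IsOpen U) (hF : IsFinsler U F) (hx : x ∈ U) (hy : y ∈ slit n) {c : ℝ}
    (hc : 0 < c) : gmat F x (c • y) = gmat F x y := by
  ext i j
  have h := HomSlit.pdy (d := 0) hU (hF.smooth_Fsq.pdy hU i)
    (HomSlit.pdy hU hF.smooth_Fsq hF.hom_Fsq i) j x hx y hy c hc
  simp [gmat, h]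

lemma isSpray (hU : IsOpen U) (hF : IsFinsler U F) : IsSpray U (sprayF F) := by
  have hL := hF.smooth_Fsq
  refine ⟨fun i => ?_, fun i x hx y hy c hc => ?_⟩
  · exact (SmoothSlit.const (1 / 4)).mul (.sum fun l =>
      (SmoothSlit.matrix_inv (hF.smooth_gmat hU)
        (fun _ hx _ hy => hF.det_gmat_ne_zero hx hy) i l).mul
      ((SmoothSlit.sum fun k => (SmoothSlit.coord k).mul ((hL.pdx hU k).pdy hU l)).sub
        (hL.pdx hU l)))
  · have h1 (k l : Fin n) := HomSlit.pdy (d := 1) hU (hL.pdx hU k)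
      (HomSlit.pdx hU hL hF.hom_Fsq k) l x hx y hy c hc
    have h2 (l : Fin n) := HomSlit.pdx hU hL hF.hom_Fsq l x hx y hy c hc
    simp only [sprayF, hF.gmat_smul hU hx hy hc, h1, h2, Pi.smul_apply, smul_eq_mul,
      Finset.mul_sum, mul_sub, Finset.sum_sub_distrib]
    congr 1
    · exact Finset.sum_congr rfl fun l _ => Finset.sum_congr rfl fun k _ => by ring
    · exact Finset.sum_congr rfl fun l _ => by ring

/-- The Euler–Lagrange form of the geodesic spray. -/
lemma sum_hess_mul_sprayF (hF : IsFinsler U F) (hx : x ∈ U) (hy : y ∈ slit n) (i : Fin n) :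
    2 * ∑ j, pdy (pdy (Fsq F) i) j x y * sprayF F j x y =
      ∑ k, y k * pdy (pdx (Fsq F) k) i x y - pdx (Fsq F) i x y := by
  set b : Fin n → ℝ := fun l => ∑ k, y k * pdy (pdx (Fsq F) k) l x y - pdx (Fsq F) l x y
  have h : (gmat F x y).mulVec ((gmat F x y)⁻¹.mulVec b) i = b i := by
    rw [Matrix.mulVec_mulVec,
      Matrix.mul_nonsing_inv _ (isUnit_iff_ne_zero.2 (hF.det_gmat_ne_zero hx hy)),
      Matrix.one_mulVec]
  refine Eq.trans ?_ h
  simp only [Matrix.mulVec, dotProduct, gmat, Finset.mul_sum]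
  refine Finset.sum_congr rfl fun j _ => ?_
  rw [sprayF, ← Finset.mul_sum]
  simp only [b]
  ring

lemma sum_pdx_Fsq_mul (hU : IsOpen U) (hF : IsFinsler U F) (hx : x ∈ U) (hy : y ∈ slit n) :
    ∑ k, pdx (Fsq F) k x y * y k = 2 * ∑ j, sprayF F j x y * pdy (Fsq F) j x y := by
  have hL := hF.smooth_Fsq
  have e1 (j : Fin n) : ∑ i, pdy (pdy (Fsq F) i) j x y * y i = pdy (Fsq F) j x y := by
    simp only [pdy_pdy_comm hU hL hx hy _ j]
    simpa using HomSlit.euler (d := 1) hU (hL.pdy hU j) (HomSlit.pdy hU hL hF.hom_Fsq j) hx hy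
  have e2 (k : Fin n) : ∑ i, pdy (pdx (Fsq F) k) i x y * y i = 2 * pdx (Fsq F) k x y := by
    simpa using HomSlit.euler hU (hL.pdx hU k) (HomSlit.pdx hU hL hF.hom_Fsq k) hx hy
  have h := Finset.sum_congr rfl fun i (_ : i ∈ Finset.univ) =>
    congrArg (· * y i) (hF.sum_hess_mul_sprayF hx hy i)
  have l : ∑ i, 2 * (∑ j, pdy (pdy (Fsq F) i) j x y * sprayF F j x y) * y i =
      2 * ∑ j, sprayF F j x y * pdy (Fsq F) j x y := by
    simp only [← e1, Finset.mul_sum, Finset.sum_mul]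
    rw [Finset.sum_comm]
    exact Finset.sum_congr rfl fun j _ => Finset.sum_congr rfl fun i _ => by ring
  have r : ∑ i, (∑ k, y k * pdy (pdx (Fsq F) k) i x y - pdx (Fsq F) i x y) * y i =
      ∑ k, pdx (Fsq F) k x y * y k := by
    have : ∑ i, (∑ k, y k * pdy (pdx (Fsq F) k) i x y) * y i =
        ∑ k, y k * (2 * pdx (Fsq F) k x y) := by
      simp only [← e2, Finset.mul_sum, Finset.sum_mul]
      rw [Finset.sum_comm]
      exact Finset.sum_congr rfl fun j _ => Finset.sum_congr rfl fun i _ => by ring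
    simp only [sub_mul, Finset.sum_sub_distrib, this]
    rw [← Finset.sum_sub_distrib]
    exact Finset.sum_congr rfl fun i _ => by ring
  exact (l.symm.trans (h.trans r)).symm

/-- `F²` is horizontally constant with respect to its own spray. -/
lemma pdx_Fsq_eq (hU : IsOpen U) (hF : IsFinsler U F) (hx : x ∈ U) (hy : y ∈ slit n)
    (i : Fin n) :
    pdx (Fsq F) i x y = ∑ l, Nc (sprayF F) l i x y * pdy (Fsq F) l x y := by
  have hL := hF.smooth_Fsq
  have hG := hF.isSpray hU
  have hsm (j : Fin n) := (hG.smooth j).mul (hL.pdy hU j)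
  have h := pdy_congr (g := fun x y => 2 * ∑ j, sprayF F j x y * pdy (Fsq F) j x y)
    (fun x hx y hy => hF.sum_pdx_Fsq_mul hU hx hy) hx hy i
  rw [pdy_sum_mul_coord hU (fun k => hL.pdx hU k) hx hy,
    pdy_mul hU (.const 2) (.sum hsm) hx hy, pdy_base (fun _ => 2), pdy_sum hU hsm hx hy] at h
  simp only [pdy_mul hU (hG.smooth _) (hL.pdy hU _) hx hy, Finset.sum_add_distrib] at h
  have h2 := hF.sum_hess_mul_sprayF hx hy i
  simp only [mul_comm (y _), pdy_pdy_comm hU hL hx hy i,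
    mul_comm (pdy (pdy (Fsq F) _) _ x y)] at h2
  simp only [Nc]
  linarith

lemma sum_pdx_mul (hU : IsOpen U) (hF : IsFinsler U F) (hx : x ∈ U) (hy : y ∈ slit n) :
    ∑ k, pdx F k x y * y k = 2 * ∑ j, sprayF F j x y * pdy F j x y := by
  have h := hF.sum_pdx_Fsq_mul hU hx hy
  simp only [hF.pdx_Fsq hU hx hy, hF.pdy_Fsq hU hx hy, mul_assoc, mul_left_comm (sprayF F _ x y),
    ← Finset.mul_sum] at h
  have hpos := hF.pos hx hy
  apply mul_left_cancel₀ hpos.ne'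
  linarith

/-- Horizontal derivative of `κ(x) F²` along the spray `G^i - c F y^i`. -/
lemma hD_base_mul_Fsq (hU : IsOpen U) (hF : IsFinsler U F) (c : ℝ) {κ : Vec n → ℝ}
    (hκ : ContDiffOn ℝ (⊤ : ℕ∞) κ U) (hx : x ∈ U) (hy : y ∈ slit n) (k : Fin n) :
    hD (fun i x y => sprayF F i x y + -c * F x y * y i) (fun x y => κ x * Fsq F x y) k x y =
      (fderiv ℝ κ x (Pi.single k 1) + 4 * c * κ x * pdy F k x y) * Fsq F x y := by
  have hL := hF.smooth_Fsq
  have hP : SmoothSlit U (fun x y => -c * F x y) := (SmoothSlit.const (-c)).mul hF.smooth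
  have eL : ∑ l, pdy (Fsq F) l x y * y l = 2 * Fsq F x y := by
    simpa using HomSlit.euler hU hL hF.hom_Fsq hx hy
  have eP : pdy (fun x y => -c * F x y) k x y = -c * pdy F k x y := by
    rw [pdy_mul hU (.const _) hF.smooth hx hy, pdy_base (fun _ => -c)]
    ring
  have e (l : Fin n) : Nc (fun i x y => sprayF F i x y + -c * F x y * y i) l k x y
        * (κ x * pdy (Fsq F) l x y) =
      κ x * (Nc (sprayF F) l k x y * pdy (Fsq F) l x y)
        + κ x * (-c * pdy F k x y) * (pdy (Fsq F) l x y * y l)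
        + if l = k then κ x * (-c * F x y) * pdy (Fsq F) k x y else 0 := by
    rw [Nc_projective hU (hF.isSpray hU) hP hx hy, eP]
    by_cases h : l = k
    · subst h; simp; ring
    · simp [h]; ring
  have hpy (l : Fin n) : pdy (fun x y => κ x * Fsq F x y) l x y = κ x * pdy (Fsq F) l x y := by
    rw [pdy_mul hU (.base hκ) hL hx hy, pdy_base κ]
    ring
  simp only [hD, hpy, e, Finset.sum_add_distrib, ← Finset.mul_sum, eL, Finset.sum_ite_eq',
    Finset.mem_univ, if_true]
  rw [pdx_mul hU (.base hκ) hL hx hy, hF.pdx_Fsq_eq hU hx hy, hF.pdy_Fsq hU hx hy, Fsq,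
    show pdx (fun x _ => κ x) k x y = fderiv ℝ κ x (Pi.single k 1) from rfl]
  ring

end IsFinsler

end Finsler

/-- Proposition 3.1: for an Einstein Finsler metric of constant S-curvature (w.r.t. the
Busemann–Hausdorff volume form), `W^o_k = F³ (θ/F)_{·k}` with `θ = σ_{x^m} y^m`. -/
theorem stmt_5 {n : ℕ} (hn : 2 ≤ n) (U : Set (Vec n)) (hU : IsOpen U) (hUne : U.Nonempty)
    (F : Vec n → Vec n → ℝ) (hF : IsFinsler U F) (c : ℝ) (sig : Vec n → ℝ)
    (hsig : ContDiffOn ℝ (⊤ : ℕ∞) sig U)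
    (hS : ∀ x ∈ U, ∀ y ∈ slit n,
      Scurv (sprayF F) (sigmaBH F) x y = ((n : ℝ) + 1) * c * F x y)
    (hEin : ∀ x ∈ U, ∀ y ∈ slit n,
      ∑ m, Riem (sprayF F) m m x y = ((n : ℝ) - 1) * sig x * (F x y) ^ 2) :
    ∀ x ∈ U, ∀ y ∈ slit n, ∀ k : Fin n,
      BWeyl (sprayF F) (sigmaBH F) k x y =
        (F x y) ^ 3 *
          pdy (fun x' y' =>
            (∑ m, fderiv ℝ sig x' (Pi.single m 1) * y' m) / F x' y') k x y := by
  intro x hx y hy k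
  have hn1 : (n : ℝ) + 1 ≠ 0 := by positivity
  have hn2 : (n : ℝ) - 1 ≠ 0 := by
    have : (2 : ℝ) ≤ n := by exact_mod_cast hn
    linarith
  have hG := hF.isSpray hU
  have hL := hF.smooth_Fsq
  have hP : SmoothSlit U (fun x y => -c * F x y) := (SmoothSlit.const (-c)).mul hF.smooth
  have hP1 : HomSlit U 1 (fun x y => -c * F x y) := fun x hx y hy a ha => by
    simp only [hF.hom x hx y hy a ha]
    ring
  have hκ : ContDiffOn ℝ (⊤ : ℕ∞) (fun x => sig x + c ^ 2) U := hsig.add contDiffOn_const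
  have hκ' (x : Vec n) : fderiv ℝ (fun x => sig x + c ^ 2) x = fderiv ℝ sig x :=
    fderiv_add_const _
  have hH := hG.projective hP hP1
  have hGhat : ∀ i, ∀ x ∈ U, ∀ y ∈ slit n, Ghat (sprayF F) (sigmaBH F) i x y =
      sprayF F i x y + -c * F x y * y i := fun i x hx y hy => by
    rw [Ghat, hS x hx y hy]
    field_simp
    ring
  have hRic : ∀ x ∈ U, ∀ y ∈ slit n, Ricci (Ghat (sprayF F) (sigmaBH F)) x y =
      (sig x + c ^ 2) * Fsq F x y := fun x hx y hy => by
    have hPx (j : Fin n) : pdx (fun x y => -c * F x y) j x y = -c * pdx F j x y := by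
      rw [pdx_mul hU (.const _) hF.smooth hx hy, pdx_fibre (fun _ => -c)]
      ring
    have hPy (j : Fin n) : pdy (fun x y => -c * F x y) j x y = -c * pdy F j x y := by
      rw [pdy_mul hU (.const _) hF.smooth hx hy, pdy_base (fun _ => -c)]
      ring
    simp only [Ricci, Riem_congr hU hGhat hx hy]
    rw [sum_Riem_projective hU hG hP hP1 hx hy, hEin x hx y hy, div_eq_iff hn2]
    simp only [hPx, hPy, mul_assoc, mul_left_comm (sprayF F _ x y), ← Finset.mul_sum,
      hF.sum_pdx_mul hU hx hy, Fsq]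
    ring
  have hK : SmoothSlit U (fun x y => (sig x + c ^ 2) * Fsq F x y) := (SmoothSlit.base hκ).mul hL
  have hdsig (m : Fin n) : SmoothSlit U (fun x _ => fderiv ℝ sig x (Pi.single m 1)) :=
    .base ((hsig.fderiv_of_isOpen hU (by simp)).clm_apply contDiffOn_const)
  have hθ : SmoothSlit U (fun x y => ∑ m, fderiv ℝ sig x (Pi.single m 1) * y m) :=
    .sum fun m => (hdsig m).mul (.coord m)
  have hθk : pdy (fun x y => ∑ m, fderiv ℝ sig x (Pi.single m 1) * y m) k x y =
      fderiv ℝ sig x (Pi.single k 1) := by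
    rw [pdy_sum_mul_coord hU hdsig hx hy]
    simp only [pdy_base (fun x => fderiv ℝ sig x (Pi.single _ 1)), zero_mul,
      Finset.sum_const_zero, zero_add]
  have hquot : SmoothSlit U
      (fun x y => (∑ m, fderiv ℝ sig x (Pi.single m 1) * y m) / F x y) :=
    ContDiffOn.div hθ hF.smooth fun p hp => (hF.pos hp.1 hp.2).ne'
  have hcontr : ∀ x ∈ U, ∀ y ∈ slit n,
      ∑ m, hD (fun i x y => sprayF F i x y + -c * F x y * y i)
        (fun x y => (sig x + c ^ 2) * Fsq F x y) m x y * y m =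
      (∑ m, fderiv ℝ sig x (Pi.single m 1) * y m + 4 * c * (sig x + c ^ 2) * F x y)
        * Fsq F x y := fun x hx y hy => by
    have eF : ∑ m, pdy F m x y * y m = F x y := by
      simpa using HomSlit.euler hU hF.smooth hF.hom hx hy
    rw [← eF]
    simp only [hF.hD_base_mul_Fsq hU c hκ hx hy, hκ', Finset.mul_sum, ← Finset.sum_add_distrib,
      Finset.sum_mul]
    exact Finset.sum_congr rfl fun m _ => by ring
  have hquot_pdy := pdy_congr (f := fun x y => ∑ m, fderiv ℝ sig x (Pi.single m 1) * y m)
    (g := fun x y => (∑ m, fderiv ℝ sig x (Pi.single m 1) * y m) / F x y * F x y)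
    (fun x hx y hy => (div_mul_cancel₀ _ (hF.pos hx hy).ne').symm) hx hy k
  rw [hθk, pdy_mul hU hquot hF.smooth hx hy] at hquot_pdy
  have hcF : SmoothSlit U (fun x y => 4 * c * (sig x + c ^ 2) * F x y) :=
    ((SmoothSlit.const (4 * c)).mul (.base hκ)).mul hF.smooth
  have hcF_pdy : pdy (fun x y => 4 * c * (sig x + c ^ 2) * F x y) k x y =
      4 * c * (sig x + c ^ 2) * pdy F k x y := by
    rw [pdy_mul hU ((SmoothSlit.const (4 * c)).mul (.base hκ)) hF.smooth hx hy,
      pdy_base (fun x => 4 * c * (sig x + c ^ 2))]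
    ring
  have hF0 := (hF.pos hx hy).ne'
  simp only [BWeyl, hD_congr hU hGhat hRic hx hy,
    covD1_congr hU hGhat (fun j _ hx _ hy => pdy_congr hRic hx hy j) hx hy]
  rw [sum_covD1_pdy_mul hU hH hK hx hy, pdy_congr hcontr hx hy,
    pdy_mul hU (hθ.add hcF) hL hx hy, pdy_add hU hθ hcF hx hy, hθk, hcF_pdy,
    hF.hD_base_mul_Fsq hU c hκ hx hy, hκ', hF.pdy_Fsq hU hx hy, Fsq]
  have hpdy : pdy (fun x y => (∑ m, fderiv ℝ sig x (Pi.single m 1) * y m) / F x y) k x y =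
      (fderiv ℝ sig x (Pi.single k 1)
        - (∑ m, fderiv ℝ sig x (Pi.single m 1) * y m) / F x y * pdy F k x y) / F x y := by
    rw [eq_div_iff hF0]
    linarith
  rw [hpdy]
  field_simp
  ring

end BerwaldWeyl
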